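/- arXiv:2102.03426 — 2 statements merged into one kernel-verified Lean document; each statement's English description precedes it below -/
import Mathlib

section
/- Let V be a finite set and E a directed acyclic graph on V, with parent sets pa(i) and reachability order ≤ (the transitive closure poset D^tr). For each i ∈ V let θ_0^{(i)}, θ_1^{(i)} be real numbers with θ_0^{(i)} + θ_1^{(i)} = 1. Let g ⊆ V be an order ideal of D^tr and let φ(g) : V → Fin 2 be given by φ(g)_i = 0 if i ∈ g and 1 otherwise. Then the CBN probability of g equals the 2-state D-MLBN probability of φ(g) with parameters interchanged: ∏_{i ∈ V} b_i(g; θ_0^{(i)}, θ_1^{(i)}) = ∏_{i ∈ V} c_i(φ(g); θ_1^{(i)}, θ_0^{(i)}), where b_i(g; θ_0, θ_1) = θ_1 if every j < i lies in g and i ∈ g; = θ_0 if every j < i lies in g and i ∉ g; = 1 if some j < i is not in g and i ∉ g; = 0 otherwise; and, with M_i(h) = max_{j ∈ pa(i)} h_j (equal to 0 if pa(i) = ∅), c_i(h; θ_0, θ_1) = 0 if h_i < M_i(h); = θ_0 + ··· + θ_{M_i(h)} if h_i = M_i(h); = θ_{h_i} if h_i > M_i(h). -/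
open scoped Classical

/-- The CBN local factor `b_i(g; θ0, θ1)` on the transitive closure poset of the DAG `E`. -/
noncomputable def cbnFactor {V : Type*} (E : V → V → Prop) (g : Set V) (i : V)
    (θ0 θ1 : ℝ) : ℝ :=
  if ∀ j : V, Relation.TransGen E j i → j ∈ g then (if i ∈ g then θ1 else θ0)
  else (if i ∈ g then 0 else 1)

/-- The D-MLBN local factor `c_i(h; θ)` of formula (4). -/
noncomputable def dmlbnFactor {V : Type*} [Fintype V] (E : V → V → Prop) {k : ℕ}
    (h : V → Fin (k + 1)) (i : V) (θ : Fin (k + 1) → ℝ) : ℝ :=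
  if h i < (Finset.univ.filter (fun j => E j i)).sup h then 0
  else if h i = (Finset.univ.filter (fun j => E j i)).sup h then
    ∑ ℓ ∈ Finset.Iic ((Finset.univ.filter (fun j => E j i)).sup h), θ ℓ
  else θ (h i)

/-- An order ideal contains every strict ancestor of `i` as soon as it contains every parent. -/
theorem ancestors_mem_iff_parents_mem {V : Type*} {E : V → V → Prop} {g : Set V}
    (hg : ∀ i ∈ g, ∀ j : V, Relation.TransGen E j i → j ∈ g) (i : V) :
    (∀ j : V, Relation.TransGen E j i → j ∈ g) ↔ ∀ j : V, E j i → j ∈ g := by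
  refine ⟨fun h j hj => h j (.single hj), fun h j hj => ?_⟩
  rcases Relation.TransGen.tail'_iff.mp hj with ⟨p, hjp, hpi⟩
  rcases Relation.reflTransGen_iff_eq_or_transGen.mp hjp with rfl | hjp
  · exact h _ hpi
  · exact hg p (h p hpi) j hjp

/-- The maximum over the parents of the indicator of the complement of `g`. -/
theorem sup_parents_indicator_compl {V : Type*} [Fintype V] (E : V → V → Prop) (g : Set V)
    (i : V) :
    (Finset.univ.filter (fun j => E j i)).sup (fun v : V => if v ∈ g then (0 : Fin 2) else 1) =
      if ∀ j : V, E j i → j ∈ g then 0 else 1 := by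
  split_ifs with h
  · refine le_antisymm (Finset.sup_le fun j hj => ?_) (Fin.zero_le _)
    simp [h j (Finset.mem_filter.mp hj).2]
  · push Not at h
    obtain ⟨j, hj, hjg⟩ := h
    refine le_antisymm (Fin.le_last _) ?_
    have := Finset.le_sup (f := fun v : V => if v ∈ g then (0 : Fin 2) else 1)
      (show j ∈ Finset.univ.filter (fun j => E j i) by simpa using hj)
    simpa only [if_neg hjg] using this

/-- Vertexwise equality of the CBN factor and the 2-state D-MLBN factor with interchanged
parameters. -/
theorem cbnFactor_eq_dmlbnFactor {V : Type*} [Fintype V] (E : V → V → Prop) {g : Set V}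
    (hg : ∀ i ∈ g, ∀ j : V, Relation.TransGen E j i → j ∈ g) (i : V) {a b : ℝ}
    (hab : a + b = 1) :
    cbnFactor E g i a b =
      dmlbnFactor E (fun v : V => if v ∈ g then (0 : Fin 2) else 1) i
        (fun ℓ : Fin 2 => if ℓ = 0 then b else a) := by
  have hIic0 : Finset.Iic (0 : Fin 2) = {0} := by decide
  have hIic1 : Finset.Iic (1 : Fin 2) = {0, 1} := by decide
  unfold cbnFactor dmlbnFactor
  rw [sup_parents_indicator_compl, ancestors_mem_iff_parents_mem hg]
  by_cases hp : ∀ j : V, E j i → j ∈ g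
  · by_cases hi : i ∈ g
    · simp only [if_pos hp, if_pos hi, hIic0]
      simp
    · simp only [if_pos hp, if_neg hi]
      simp
  · have hi : i ∉ g := fun hi => hp fun j hj => hg i hi j (.single hj)
    simp only [if_neg hp, if_neg hi, hIic1]
    simp [← hab, add_comm]

/-- For a DAG `E` with `θ0 i + θ1 i = 1` for every vertex, an order
ideal `g` of the transitive closure poset, and `φ(g)_i = 0` iff `i ∈ g`, the CBN
probability of `g` equals the 2-state D-MLBN probability of `φ(g)` with the parameters
interchanged at every vertex. -/
theorem stmt_6 {V : Type*} [Fintype V] (E : V → V → Prop)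
    (hacyc : ∀ i : V, ¬ Relation.TransGen E i i)
    (θ0 θ1 : V → ℝ) (hθ : ∀ i : V, θ0 i + θ1 i = 1)
    (g : Set V) (hg : ∀ i ∈ g, ∀ j : V, Relation.TransGen E j i → j ∈ g) :
    ∏ i : V, cbnFactor E g i (θ0 i) (θ1 i) =
      ∏ i : V, dmlbnFactor E (fun v : V => if v ∈ g then (0 : Fin 2) else 1) i
        (fun ℓ : Fin 2 => if ℓ = 0 then θ1 i else θ0 i) := by
  exact Finset.prod_congr rfl fun i _ => cbnFactor_eq_dmlbnFactor E hg i (hθ i)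
end

section
/- Let V be a finite set and E a directed acyclic graph on V with transitive closure poset D^tr. Let J denote the set of order ideals of D^tr and φ(g)_i = 0 if i ∈ g, 1 otherwise, for g ∈ J. Then the image of the CBN parameterization equals the image of the 2-state D-MLBN parameterization after relabeling coordinates by φ: the set of vectors (∏_{i ∈ V} b_i(g; θ_0^{(i)}, θ_1^{(i)}))_{g ∈ J} as the parameters range over all choices with θ_0^{(i)}, θ_1^{(i)} ≥ 0 and θ_0^{(i)} + θ_1^{(i)} = 1 for every i, is equal to the set of vectors (∏_{i ∈ V} c_i(φ(g); θ_0^{(i)}, θ_1^{(i)}))_{g ∈ J} as the parameters range over the same set. -/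
open scoped Classical

/-- On an order ideal, all proper predecessors of `i` belong to the ideal iff all parents do. -/
lemma forall_transGen_mem_iff {V : Type*} {E : V → V → Prop} {g : Set V}
    (hg : ∀ i ∈ g, ∀ j : V, Relation.TransGen E j i → j ∈ g) (i : V) :
    (∀ j, Relation.TransGen E j i → j ∈ g) ↔ ∀ j, E j i → j ∈ g := by
  refine ⟨fun h j hj => h j (.single hj), fun h j hj => ?_⟩
  cases hj with
  | single hj => exact h j hj
  | tail hjk hki => exact hg _ (h _ hki) j hjk

/-- The maximum over the parents of `i` of the indicator of `gᶜ` vanishes iff all parents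
lie in `g`. -/
lemma sup_parents_indicator {V : Type*} [Fintype V] (E : V → V → Prop) (g : Set V) (i : V) :
    (Finset.univ.filter (fun j => E j i)).sup (fun x => if x ∈ g then (0 : Fin 2) else 1) =
      if ∀ j, E j i → j ∈ g then 0 else 1 := by
  split_ifs with h
  · rw [← bot_eq_zero, Finset.sup_eq_bot_iff]
    intro j hj
    simp [h j (Finset.mem_filter.1 hj).2]
  · push Not at h
    obtain ⟨j, hj, hjg⟩ := h
    refine le_antisymm (Fin.le_last _) ?_
    simpa [hjg] using Finset.le_sup (f := fun x => if x ∈ g then (0 : Fin 2) else 1)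
      (Finset.mem_filter.2 ⟨Finset.mem_univ j, hj⟩)

/-- On order ideals, the 2-state D-MLBN factor is the CBN factor with swapped parameters. -/
lemma dmlbnFactor_indicator_eq_cbnFactor {V : Type*} [Fintype V] {E : V → V → Prop} {g : Set V}
    (hg : ∀ i ∈ g, ∀ j : V, Relation.TransGen E j i → j ∈ g) (i : V) {θ0 θ1 : ℝ}
    (hθ : θ0 + θ1 = 1) :
    dmlbnFactor E (fun x : V => if x ∈ g then (0 : Fin 2) else 1) i
      (fun ℓ : Fin 2 => if ℓ = 0 then θ0 else θ1) = cbnFactor E g i θ1 θ0 := by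
  have h0 : Finset.Iic (0 : Fin 2) = {0} := rfl
  have h1 : Finset.Iic (1 : Fin 2) = {0, 1} := rfl
  unfold dmlbnFactor cbnFactor
  rw [sup_parents_indicator, forall_transGen_mem_iff hg]
  by_cases h : ∀ j, E j i → j ∈ g
  · simp only [if_pos h]
    by_cases hi : i ∈ g <;> simp [hi, h0]
  · simp only [if_neg h]
    by_cases hi : i ∈ g <;> simp [hi, h1, hθ]

/-- For a DAG `E`, with `J` the collection of order ideals of the
transitive closure poset and `φ(g)_i = 0` iff `i ∈ g`, the image of the CBN
parameterization (as probability parameters `θ0 i, θ1 i ≥ 0`, `θ0 i + θ1 i = 1` vary)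
equals the image of the 2-state D-MLBN parameterization in the coordinates relabeled
by `φ`. -/
theorem stmt_7 {V : Type*} [Fintype V] (E : V → V → Prop)
    (hacyc : ∀ i : V, ¬ Relation.TransGen E i i) :
    {v : {g : Set V // ∀ i ∈ g, ∀ j : V, Relation.TransGen E j i → j ∈ g} → ℝ |
        ∃ θ0 θ1 : V → ℝ, (∀ i : V, 0 ≤ θ0 i) ∧ (∀ i : V, 0 ≤ θ1 i) ∧
          (∀ i : V, θ0 i + θ1 i = 1) ∧
          ∀ g, v g = ∏ i : V, cbnFactor E g.1 i (θ0 i) (θ1 i)} =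
      {v : {g : Set V // ∀ i ∈ g, ∀ j : V, Relation.TransGen E j i → j ∈ g} → ℝ |
        ∃ θ0 θ1 : V → ℝ, (∀ i : V, 0 ≤ θ0 i) ∧ (∀ i : V, 0 ≤ θ1 i) ∧
          (∀ i : V, θ0 i + θ1 i = 1) ∧
          ∀ g, v g = ∏ i : V,
            dmlbnFactor E (fun x : V => if x ∈ g.1 then (0 : Fin 2) else 1) i
              (fun ℓ : Fin 2 => if ℓ = 0 then θ0 i else θ1 i)} := by
  ext v
  constructor
  · rintro ⟨θ0, θ1, h0, h1, hθ, hv⟩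
    have hθ' : ∀ i, θ1 i + θ0 i = 1 := fun i => (add_comm _ _).trans (hθ i)
    refine ⟨θ1, θ0, h1, h0, hθ', fun g => (hv g).trans ?_⟩
    exact Finset.prod_congr rfl fun i _ =>
      (dmlbnFactor_indicator_eq_cbnFactor g.2 i (hθ' i)).symm
  · rintro ⟨θ0, θ1, h0, h1, hθ, hv⟩
    refine ⟨θ1, θ0, h1, h0, fun i => (add_comm _ _).trans (hθ i), fun g => (hv g).trans ?_⟩
    exact Finset.prod_congr rfl fun i _ => dmlbnFactor_indicator_eq_cbnFactor g.2 i (hθ i)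
end
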